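/- In the exterior Dirichlet setting with x₀ = R·eₙ ∈ ∂B_R, δ = R^{3/4}, Ω_δ = B_δ(x₀) ∩ B_R, d(x) = R − |x|, u = u^R, and L the linearized operator Lw = u^{ij}w_{ij} − (n+2)/(1+|Du|²)·uⁱw_i, define ϑ := (u − u̲) + R^{−1/2}·d − (1/2)·R^{−5/4}·d². Then there exists ε > 0 independent of R such that for all sufficiently large R: Lϑ ≤ −ε·R^{3/(4n)} − ε·R^{−5/4}·tr(u^{ij}) in Ω_δ, and ϑ ≥ 0 on ∂Ω_δ, where tr(u^{ij}) = Σ_i u^{ii} and (u^{ij}) is the inverse Hessian of u. -/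

import Mathlib

open Metric Set Filter
open scoped Topology RealInnerProductSpace

noncomputable section

abbrev Euc (n : ℕ) : Type := EuclideanSpace ℝ (Fin n)

/-- The Hessian matrix of `u` at `x`, `(u_{ij})`. -/
noncomputable def Hess {n : ℕ} (u : Euc n → ℝ) (x : Euc n) : Matrix (Fin n) (Fin n) ℝ :=
  fun i j => iteratedFDeriv ℝ 2 u x ![EuclideanSpace.single i 1, EuclideanSpace.single j 1]

/-- The Gauß curvature operator `K[u] = det D²u / (1+|Du|²)^((n+2)/2)`. -/
noncomputable def gaussK {n : ℕ} (u : Euc n → ℝ) (x : Euc n) : ℝ :=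
  (Hess u x).det / (1 + ‖fderiv ℝ u x‖ ^ 2) ^ (((n : ℝ) + 2) / 2)

/-- Partial derivative `w_i` relative to a set `S`. -/
noncomputable def pdW {n : ℕ} (S : Set (Euc n)) (w : Euc n → ℝ) (x : Euc n) (i : Fin n) : ℝ :=
  fderivWithin ℝ w S x (EuclideanSpace.single i 1)

/-- The Hessian matrix `(w_{ij})` relative to a set `S`. -/
noncomputable def HessW {n : ℕ} (S : Set (Euc n)) (w : Euc n → ℝ) (x : Euc n) :
    Matrix (Fin n) (Fin n) ℝ :=
  fun i j => iteratedFDerivWithin ℝ 2 w S x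
    ![EuclideanSpace.single i 1, EuclideanSpace.single j 1]

/-- The exterior Dirichlet setting of Finster–Schnürer. -/
structure ExtSetting (n : ℕ) where
  K : Set (Euc n)
  f : Euc n → ℝ → ℝ
  u₀ : Euc n → ℝ
  ul : Euc n → ℝ
  R₀ : ℝ
  hn : 2 ≤ n
  hR₀ : 0 < R₀
  hKne : K.Nonempty
  hKc : IsCompact K
  hK0 : 0 ∈ interior K
  hKsm : ∃ g : Euc n → ℝ, ContDiff ℝ (⊤ : ℕ∞) g ∧ K = {x | g x ≤ 0} ∧
    ∀ x ∈ frontier K, fderiv ℝ g x ≠ 0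
  hKR₀ : K ⊆ ball 0 R₀
  hfsm : ContDiffOn ℝ (⊤ : ℕ∞) (fun p : Euc n × ℝ => f p.1 p.2) ((interior K)ᶜ ×ˢ univ)
  hfpos : ∀ x ∈ (interior K)ᶜ, ∀ z : ℝ, 0 < f x z
  hfz : ∀ x ∈ (interior K)ᶜ, Monotone (f x)
  hfdec : ∃ C : ℝ, ∀ x ∈ (interior K)ᶜ, ∀ z : ℝ, f x z * ‖x‖ ^ (n + 1) ≤ C
  hfder : ∃ C : ℝ, ∀ p ∈ (interior K)ᶜ ×ˢ (univ : Set ℝ),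
    ‖fderivWithin ℝ (fun q : Euc n × ℝ => f q.1 q.2) ((interior K)ᶜ ×ˢ univ) p‖ +
      ‖iteratedFDerivWithin ℝ 2 (fun q : Euc n × ℝ => f q.1 q.2) ((interior K)ᶜ ×ˢ univ) p‖
        ≤ C * f p.1 p.2
  hulsm : ContDiffOn ℝ (⊤ : ℕ∞) ul (interior K)ᶜ
  hulconv : ∀ x ∈ Kᶜ, (Hess ul x).PosDef
  hulsub : ∀ x ∈ Kᶜ, f x (ul x) ≤ gaussK ul x
  hulbc : ∀ x ∈ frontier K, ul x = u₀ x
  hulcone : ∃ C : ℝ, ∀ x ∈ (interior K)ᶜ, |ul x - ‖x‖| ≤ C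
  huldec1 : ∃ C R₁ : ℝ, ∀ x : Euc n, R₁ ≤ ‖x‖ →
    ‖fderiv ℝ (fun y => ul y - ‖y‖) x‖ ≤ C / ‖x‖
  huldec2 : ∃ C R₁ : ℝ, ∀ x : Euc n, R₁ ≤ ‖x‖ →
    ‖iteratedFDeriv ℝ 2 (fun y => ul y - ‖y‖) x‖ + ‖iteratedFDeriv ℝ 3 ul x‖ ≤ C / ‖x‖ ^ 2

/-- The domain `B_R ∖ int K` of the compact Dirichlet problem. -/
def solDom {n : ℕ} (S : ExtSetting n) (R : ℝ) : Set (Euc n) :=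
  closedBall 0 R \ interior S.K

/-- `u` is a smooth strictly convex solution `u^R` of the compact Dirichlet problem
`K[u^R] = f(x,u^R)` in `B_R ∖ K`, `u^R = u̲` on `∂B_R ∪ ∂K`. -/
def IsSol {n : ℕ} (S : ExtSetting n) (R : ℝ) (u : Euc n → ℝ) : Prop :=
  ContDiffOn ℝ (⊤ : ℕ∞) u (solDom S R) ∧
  (∀ x ∈ ball 0 R \ S.K, (Hess u x).PosDef) ∧
  (∀ x ∈ ball 0 R \ S.K, gaussK u x = S.f x (u x)) ∧
  (∀ x ∈ sphere (0 : Euc n) R ∪ frontier S.K, u x = S.ul x)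

/-- The linearized operator `Lw = u^{ij} w_{ij} − (n+2)/(1+|Du|²) uⁱ w_i`. -/
noncomputable def Llin {n : ℕ} (Ω : Set (Euc n)) (u w : Euc n → ℝ) (x : Euc n) : ℝ :=
  (∑ i, ∑ j, (HessW Ω u x)⁻¹ i j * HessW Ω w x i j) -
    ((n : ℝ) + 2) / (1 + ∑ i, pdW Ω u x i ^ 2) * ∑ i, pdW Ω u x i * pdW Ω w x i

/-- The barrier function `ϑ = (u − u̲) + R^{-1/2} d − (1/2) R^{-5/4} d²`, `d = R − |x|`. -/
noncomputable def vartheta {n : ℕ} (R : ℝ) (u ul : Euc n → ℝ) (x : Euc n) : ℝ :=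
  (u x - ul x) + R ^ (-(1 : ℝ) / 2) * (R - ‖x‖) - 1 / 2 * R ^ (-(5 : ℝ) / 4) * (R - ‖x‖) ^ 2

section MatrixLemmas

variable {m : Type*} [Fintype m]

theorem Matrix.star_dotProduct_mulVec_eq_sum (M : Matrix m m ℝ) (v : m → ℝ) :
    star v ⬝ᵥ M.mulVec v = ∑ i, ∑ j, v i * v j * M i j := by
  simp [dotProduct, Matrix.mulVec, Finset.mul_sum, mul_left_comm, mul_comm]

theorem Matrix.posSemidef_of_sum {M : Matrix m m ℝ} (hs : ∀ i j, M i j = M j i)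
    (hq : ∀ v : m → ℝ, 0 ≤ ∑ i, ∑ j, v i * v j * M i j) : M.PosSemidef := by
  refine Matrix.PosSemidef.of_dotProduct_mulVec_nonneg ?_ fun v => ?_
  · ext i j
    simpa using hs j i
  · rw [Matrix.star_dotProduct_mulVec_eq_sum]
    exact hq v

variable [DecidableEq m]

open scoped ComplexOrder MatrixOrder in
theorem Matrix.PosSemidef.exists_conjTranspose_mul_self {G : Matrix m m ℝ} (hG : G.PosSemidef) :
    ∃ B : Matrix m m ℝ, G = B.conjTranspose * B :=
  CStarAlgebra.nonneg_iff_eq_star_mul_self.mp hG.nonneg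

theorem Matrix.PosSemidef.trace_mul_nonneg {G M : Matrix m m ℝ} (hG : G.PosSemidef)
    (hM : M.PosSemidef) : 0 ≤ (G * M).trace := by
  obtain ⟨B, rfl⟩ := hG.exists_conjTranspose_mul_self
  rw [Matrix.mul_assoc, Matrix.trace_mul_comm]
  exact (hM.mul_mul_conjTranspose_same B).trace_nonneg

/-- The arithmetic-geometric mean inequality for the eigenvalues of a positive matrix. -/
theorem Matrix.PosSemidef.det_le_trace_div_pow {M : Matrix m m ℝ} (hM : M.PosSemidef)
    [Nonempty m] : M.det ≤ (M.trace / Fintype.card m) ^ Fintype.card m := by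
  have hcard : (0 : ℝ) < Fintype.card m := by exact_mod_cast Fintype.card_pos
  have h := Real.geom_mean_le_arith_mean Finset.univ (fun _ : m => (1 : ℝ)) hM.1.eigenvalues
    (fun _ _ => zero_le_one) (by simpa using hcard) (fun i _ => hM.eigenvalues_nonneg i)
  have hdet : M.det = ∏ i, hM.1.eigenvalues i := by simpa using hM.1.det_eq_prod_eigenvalues
  have htr : M.trace = ∑ i, hM.1.eigenvalues i := by simpa using hM.1.trace_eq_sum_eigenvalues
  simp only [Real.rpow_one, Finset.sum_const, Finset.card_univ, nsmul_eq_mul, mul_one, one_mul]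
    at h
  rw [← hdet, ← htr] at h
  have h0 : 0 ≤ M.det := by
    rw [hdet]; exact Finset.prod_nonneg fun i _ => hM.eigenvalues_nonneg i
  calc M.det = (M.det ^ ((Fintype.card m : ℝ)⁻¹)) ^ Fintype.card m := by
        rw [Real.rpow_inv_natCast_pow h0 Fintype.card_ne_zero]
    _ ≤ _ := pow_le_pow_left₀ (Real.rpow_nonneg h0 _) h _

theorem Matrix.PosSemidef.det_mul_le_trace_div_pow {G A : Matrix m m ℝ} (hG : G.PosSemidef)
    (hA : A.PosSemidef) [Nonempty m] :
    G.det * A.det ≤ ((G * A).trace / Fintype.card m) ^ Fintype.card m := by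
  obtain ⟨B, rfl⟩ := hG.exists_conjTranspose_mul_self
  have h := (hA.mul_mul_conjTranspose_same B).det_le_trace_div_pow
  rw [Matrix.mul_assoc, Matrix.trace_mul_comm]
  convert h using 1
  simp only [Matrix.det_mul]
  ring

/-- If `B ≥ A + D` with `A`, `B` positive definite, then `det A ≤ exp (-tr (B⁻¹ D)) det B`. -/
theorem Matrix.PosDef.det_le_exp_mul_det [Nonempty m] {A B D : Matrix m m ℝ} (hA : A.PosDef)
    (hB : B.PosDef) (hD : (B - A - D).PosSemidef) :
    A.det ≤ Real.exp (-(B⁻¹ * D).trace) * B.det := by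
  have hcard : (0 : ℝ) < Fintype.card m := by exact_mod_cast Fintype.card_pos
  have hu : IsUnit B.det := hB.det_pos.ne'.isUnit
  have h1 := hB.inv.posSemidef.det_mul_le_trace_div_pow hA.posSemidef
  have h2 := hB.inv.posSemidef.trace_mul_nonneg hD
  rw [Matrix.mul_sub, Matrix.mul_sub, Matrix.nonsing_inv_mul _ hu, Matrix.trace_sub,
    Matrix.trace_sub, Matrix.trace_one] at h2
  have h0 : 0 ≤ (B⁻¹ * A).trace := hB.inv.posSemidef.trace_mul_nonneg hA.posSemidef
  have h3 : (B⁻¹ * A).trace / Fintype.card m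
      ≤ Real.exp (-(B⁻¹ * D).trace / Fintype.card m) := by
    have := Real.add_one_le_exp (-(B⁻¹ * D).trace / Fintype.card m)
    refine le_trans ?_ this
    rw [div_le_iff₀ hcard, add_mul, div_mul_cancel₀ _ hcard.ne']
    linarith
  have h4 := h1.trans (pow_le_pow_left₀ (by positivity) h3 _)
  rw [← Real.exp_nat_mul, mul_div_cancel₀ _ hcard.ne', Matrix.det_nonsing_inv,
    Ring.inverse_eq_inv'] at h4
  rwa [inv_mul_le_iff₀ hB.det_pos, mul_comm] at h4

end MatrixLemmas

section Calculus

variable {E : Type*} [NormedAddCommGroup E] [NormedSpace ℝ E]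

theorem hasDerivAt_line (x v : E) (t : ℝ) : HasDerivAt (fun t : ℝ => x + t • v) v t := by
  simpa using ((hasDerivAt_id t).smul_const v).const_add x

theorem ContDiffAt.hasDerivAt_line {f : E → ℝ} {x v : E} {t : ℝ}
    (hf : ContDiffAt ℝ 2 f (x + t • v)) :
    HasDerivAt (fun t => f (x + t • v)) (fderiv ℝ f (x + t • v) v) t :=
  (hf.differentiableAt (by norm_num)).hasFDerivAt.comp_hasDerivAt t (_root_.hasDerivAt_line x v t)

theorem ContDiffAt.hasDerivAt_fderiv_line {f : E → ℝ} {x v : E} {t : ℝ}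
    (hf : ContDiffAt ℝ 2 f (x + t • v)) :
    HasDerivAt (fun t => fderiv ℝ f (x + t • v) v)
      (iteratedFDeriv ℝ 2 f (x + t • v) ![v, v]) t := by
  have h1 : ContDiffAt ℝ 1 (fderiv ℝ f) (x + t • v) := hf.fderiv_right (by norm_num)
  have h2 := (h1.differentiableAt (by norm_num)).hasFDerivAt.comp_hasDerivAt t
    (_root_.hasDerivAt_line x v t)
  have h3 := h2.clm_apply (hasDerivAt_const t v)
  simpa [iteratedFDeriv_two_apply] using h3

theorem eventually_line {p : E → Prop} {x : E} (v : E) (h : ∀ᶠ y in 𝓝 x, p y) :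
    ∀ᶠ t : ℝ in 𝓝 0, p (x + t • v) := by
  have : Tendsto (fun t : ℝ => x + t • v) (𝓝 0) (𝓝 x) := by
    have := (_root_.hasDerivAt_line x v 0).continuousAt.tendsto
    simpa using this
  exact this.eventually h

theorem ContDiffAt.eventually_hasDerivAt_line {f : E → ℝ} {x : E} (v : E)
    (hf : ContDiffAt ℝ 2 f x) :
    ∀ᶠ t : ℝ in 𝓝 0, HasDerivAt (fun t => f (x + t • v)) (fderiv ℝ f (x + t • v) v) t :=
  (eventually_line v (hf.eventually (by simp))).mono fun _ ht => ht.hasDerivAt_line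

theorem ContDiffAt.iteratedFDeriv_two_eq {f : E → ℝ} {x v : E} (hf : ContDiffAt ℝ 2 f x)
    {g' : ℝ → ℝ} {c : ℝ} (h1 : ∀ᶠ t : ℝ in 𝓝 0, HasDerivAt (fun t => f (x + t • v)) (g' t) t)
    (h2 : HasDerivAt g' c 0) : iteratedFDeriv ℝ 2 f x ![v, v] = c := by
  have h3 := ContDiffAt.hasDerivAt_fderiv_line (t := 0) (v := v) (by simpa using hf)
  have h4 : (fun t : ℝ => fderiv ℝ f (x + t • v) v) =ᶠ[𝓝 0] g' := by
    filter_upwards [h1, hf.eventually_hasDerivAt_line v] with t ha hb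
    exact hb.unique ha
  have := (h3.congr_of_eventuallyEq h4.symm).unique h2
  simpa using this

theorem deriv2_nonneg_of_isLocalMin {g g' : ℝ → ℝ} {c : ℝ}
    (h1 : ∀ᶠ t in 𝓝 0, HasDerivAt g (g' t) t) (h2 : HasDerivAt g' c 0) (hmin : IsLocalMin g 0) :
    0 ≤ c := by
  by_contra! hc
  have e1 : deriv g =ᶠ[𝓝 0] g' := h1.mono fun t ht => ht.deriv
  have e2 : deriv (deriv g) 0 = c := by rw [e1.deriv_eq, h2.deriv]
  have hmax : IsLocalMax g 0 :=
    isLocalMax_of_deriv_deriv_neg (by rw [e2]; exact hc) hmin.deriv_eq_zero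
      h1.self_of_nhds.continuousAt
  have e3 : g =ᶠ[𝓝 0] fun _ => g 0 := by
    filter_upwards [hmin, hmax] with t ha hb using le_antisymm hb ha
  have e4 : deriv g =ᶠ[𝓝 0] fun _ => 0 := by
    simpa using e3.deriv
  have : deriv (deriv g) 0 = 0 := by simpa using e4.deriv_eq
  linarith

end Calculus

section Hessian

variable {n : ℕ}

theorem Euc.eq_sum (v : Euc n) : v = ∑ i, v i • EuclideanSpace.single i (1 : ℝ) := by
  have := (EuclideanSpace.basisFun (Fin n) ℝ).sum_repr v
  simpa using this.symm

theorem Hess_symm {u : Euc n → ℝ} {x : Euc n} (hu : ContDiffAt ℝ 2 u x) (i j : Fin n) :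
    Hess u x i j = Hess u x j i := by
  have := hu.isSymmSndFDerivAt (by simp)
  simp only [Hess, iteratedFDeriv_two_apply]
  simpa using this _ _

theorem sum_Hess (u : Euc n → ℝ) (x v : Euc n) :
    ∑ i, ∑ j, v i * v j * Hess u x i j = iteratedFDeriv ℝ 2 u x ![v, v] := by
  simp only [Hess, iteratedFDeriv_two_apply]
  simp only [Matrix.cons_val_zero, Matrix.cons_val_one]
  conv_rhs => rw [Euc.eq_sum v]
  simp only [map_sum, map_smul, _root_.sum_apply, _root_.smul_apply,
    smul_eq_mul, Finset.mul_sum]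
  rw [Finset.sum_comm]
  refine Finset.sum_congr rfl fun i _ => Finset.sum_congr rfl fun j _ => ?_
  ring

theorem iteratedFDeriv_two_pos {u : Euc n → ℝ} {x v : Euc n} (h : (Hess u x).PosDef)
    (hv : v ≠ 0) : 0 < iteratedFDeriv ℝ 2 u x ![v, v] := by
  rw [← sum_Hess]
  have hv' : (v : Fin n → ℝ) ≠ 0 := fun h0 => hv (by ext i; exact congrFun h0 i)
  have := h.dotProduct_mulVec_pos hv'
  rwa [Matrix.star_dotProduct_mulVec_eq_sum] at this

theorem HessW_eq_Hess {s : Set (Euc n)} {x : Euc n} (hs : s ∈ 𝓝 x) (w : Euc n → ℝ) :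
    HessW s w x = Hess w x := by
  have h : s =ᶠ[𝓝 x] univ := by simpa using hs
  ext i j
  simp only [HessW, Hess, iteratedFDerivWithin_congr_set h, iteratedFDerivWithin_univ]

theorem pdW_eq {s : Set (Euc n)} {x : Euc n} (hs : s ∈ 𝓝 x) (w : Euc n → ℝ) (i : Fin n) :
    pdW s w x i = fderiv ℝ w x (EuclideanSpace.single i 1) := by
  rw [pdW, fderivWithin_of_mem_nhds hs]

end Hessian
section Comparison

variable {n : ℕ}

theorem continuousAt_Hess {u : Euc n → ℝ} {x : Euc n} (hu : ContDiffAt ℝ 2 u x) :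
    ContinuousAt (Hess u) x := by
  have h1 : ContDiffAt ℝ 1 (fderiv ℝ u) x := hu.fderiv_right (by norm_num)
  have h2 : ContDiffAt ℝ 0 (fderiv ℝ (fderiv ℝ u)) x := h1.fderiv_right (by norm_num)
  refine continuousAt_pi.2 fun i => continuousAt_pi.2 fun j => ?_
  simp only [Hess, iteratedFDeriv_two_apply]
  exact (h2.continuousAt.clm_apply continuousAt_const).clm_apply continuousAt_const

theorem continuousAt_Hess_inv {u : Euc n → ℝ} {x : Euc n} (hu : ContDiffAt ℝ 2 u x)
    (hp : (Hess u x).PosDef) (i j : Fin n) : ContinuousAt (fun y => (Hess u y)⁻¹ i j) x := by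
  have hH := continuousAt_Hess hu
  have hdet : ContinuousAt (fun y => (Hess u y).det) x :=
    (continuous_id.matrix_det.continuousAt (x := Hess u x)).comp hH
  have hadj : ContinuousAt (fun y => (Hess u y).adjugate i j) x :=
    ((continuous_id.matrix_adjugate.matrix_elem i j).continuousAt (x := Hess u x)).comp hH
  simp only [Matrix.inv_def, Ring.inverse_eq_inv', Matrix.smul_apply, smul_eq_mul]
  exact (hdet.inv₀ hp.det_pos.ne').mul hadj

theorem one_add_sq_le_exp_mul {a b t : ℝ} (hb : 0 ≤ b) (ht : 0 ≤ t)
    (hab : b ≤ a + t) : 1 + b ^ 2 ≤ Real.exp (2 * t) * (1 + a ^ 2) := by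
  have h1 : 1 + 2 * t + (2 * t) ^ 2 / 2 ≤ Real.exp (2 * t) :=
    Real.quadratic_le_exp_of_nonneg (by positivity)
  have h2 : b ^ 2 ≤ (a + t) ^ 2 := pow_le_pow_left₀ hb hab 2
  have h3 : (1 + 2 * t + (2 * t) ^ 2 / 2) * (1 + a ^ 2) ≤ Real.exp (2 * t) * (1 + a ^ 2) := by
    gcongr
  nlinarith [mul_nonneg ht (sq_nonneg (a - 1)), mul_nonneg ht (sq_nonneg a), sq_nonneg (t * a),
    sq_nonneg t]

/-- Strict comparison of the curvature operators at a point where `u - v` touches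
`η exp (l xᵢ)` from above. -/
theorem gaussK_lt_of_isLocalMin {u v : Euc n → ℝ} {z : Euc n} {i₀ : Fin n} {l η : ℝ}
    (hl : 0 < l) (hη : 0 < η)
    (hu : ContDiffAt ℝ 2 u z) (hv : ContDiffAt ℝ 2 v z)
    (hpu : (Hess u z).PosDef) (hpv : (Hess v z).PosDef)
    (hb : (n : ℝ) + 2 < l * (Hess u z)⁻¹ i₀ i₀)
    (hmin : IsLocalMin (fun x => u x - v x - η * Real.exp (l * x i₀)) z) :
    gaussK v z < gaussK u z := by
  have : Nonempty (Fin n) := ⟨i₀⟩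
  set e := Real.exp (l * z i₀) with he
  have hepos : 0 < e := Real.exp_pos _
  have key : ∀ w : Euc n, fderiv ℝ u z w - fderiv ℝ v z w - η * (l * w i₀ * e) = 0 ∧
      0 ≤ iteratedFDeriv ℝ 2 u z ![w, w] - iteratedFDeriv ℝ 2 v z ![w, w]
        - η * ((l * w i₀) * (l * w i₀ * e)) := by
    intro w
    have hexp : ∀ t : ℝ, HasDerivAt (fun t : ℝ => Real.exp (l * (z + t • w) i₀))
        (l * w i₀ * Real.exp (l * (z + t • w) i₀)) t := by
      intro t
      have h1 : HasDerivAt (fun t : ℝ => l * (z + t • w) i₀) (l * w i₀) t := by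
        have := (((hasDerivAt_id t).mul_const (w i₀)).const_add (z i₀)).const_mul l
        simpa using this
      have := h1.exp
      rwa [mul_comm] at this
    have hloc : IsLocalMin (fun t : ℝ => u (z + t • w) - v (z + t • w)
        - η * Real.exp (l * (z + t • w) i₀)) 0 := by
      have := eventually_line w hmin
      simpa [IsLocalMin, IsMinFilter] using this
    have hd1 : ∀ᶠ t : ℝ in 𝓝 0, HasDerivAt (fun t : ℝ => u (z + t • w) - v (z + t • w)
        - η * Real.exp (l * (z + t • w) i₀))
        (fderiv ℝ u (z + t • w) w - fderiv ℝ v (z + t • w) w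
          - η * (l * w i₀ * Real.exp (l * (z + t • w) i₀))) t := by
      filter_upwards [hu.eventually_hasDerivAt_line w, hv.eventually_hasDerivAt_line w]
        with t ha hb
      exact (ha.sub hb).sub ((hexp t).const_mul η)
    have hd2 := ((ContDiffAt.hasDerivAt_fderiv_line (t := 0) (v := w) (by simpa using hu)).sub
      (ContDiffAt.hasDerivAt_fderiv_line (t := 0) (v := w) (by simpa using hv))).sub
        (((hexp 0).const_mul (l * w i₀)).const_mul η)
    have h1 := hloc.hasDerivAt_eq_zero hd1.self_of_nhds
    have h2 := deriv2_nonneg_of_isLocalMin hd1 hd2 hloc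
    simp only [zero_smul, add_zero] at h1 h2
    exact ⟨h1, h2⟩
  set s := η * l ^ 2 * e with hs
  have hpsd : (Hess u z - Hess v z - Matrix.single i₀ i₀ s).PosSemidef := by
    refine Matrix.posSemidef_of_sum (fun i j => ?_) (fun w => ?_)
    · simp only [Matrix.sub_apply, Hess_symm hu i j, Hess_symm hv i j, Matrix.single_apply]
      simp only [and_comm]
    · have h2 := (key (WithLp.toLp 2 w)).2
      rw [← sum_Hess, ← sum_Hess] at h2
      have h3 : ∑ i, ∑ j, w i * w j * Matrix.single i₀ i₀ s i j = w i₀ * w i₀ * s := by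
        rw [Finset.sum_eq_single i₀, Finset.sum_eq_single i₀]
        · simp
        · intro j _ hj; simp [hj.symm]
        · simp
        · intro i _ hi; simp [hi.symm]
        · simp
      simp only [Matrix.sub_apply, mul_sub, Finset.sum_sub_distrib, h3]
      have h4 : η * ((l * w i₀) * (l * w i₀ * e)) = w i₀ * w i₀ * s := by rw [hs]; ring
      rw [← h4]
      exact h2
  have hdet := hpv.det_le_exp_mul_det hpu hpsd
  have htr : ((Hess u z)⁻¹ * Matrix.single i₀ i₀ s).trace = (Hess u z)⁻¹ i₀ i₀ * s := by
    rw [Matrix.trace_mul_single, op_smul_eq_mul]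
  rw [htr] at hdet
  set t := η * l * e with ht
  have htpos : 0 < t := by positivity
  have hnorm : ‖fderiv ℝ u z‖ ≤ ‖fderiv ℝ v z‖ + t := by
    refine ContinuousLinearMap.opNorm_le_bound _ (by positivity) fun w => ?_
    have h1 := (key w).1
    have h2 : fderiv ℝ u z w = fderiv ℝ v z w + t * w i₀ := by rw [ht]; linarith
    rw [h2, add_mul]
    refine (norm_add_le _ _).trans (add_le_add ((fderiv ℝ v z).le_opNorm w) ?_)
    rw [norm_mul, Real.norm_of_nonneg htpos.le]
    exact mul_le_mul_of_nonneg_left (PiLp.norm_apply_le w i₀) htpos.le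
  have hsq := one_add_sq_le_exp_mul (norm_nonneg (fderiv ℝ u z))
    htpos.le hnorm
  set q : ℝ := ((n : ℝ) + 2) / 2 with hq
  have hqpos : 0 < q := by positivity
  have hpow : (1 + ‖fderiv ℝ u z‖ ^ 2) ^ q
      ≤ Real.exp (2 * t * q) * (1 + ‖fderiv ℝ v z‖ ^ 2) ^ q := by
    have := Real.rpow_le_rpow (by positivity) hsq hqpos.le
    rwa [Real.mul_rpow (Real.exp_pos _).le (by positivity), ← Real.exp_mul] at this
  have hpvpos : 0 < (1 + ‖fderiv ℝ v z‖ ^ 2) ^ q := by positivity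
  have hpupos : 0 < (1 + ‖fderiv ℝ u z‖ ^ 2) ^ q := by positivity
  rw [gaussK, gaussK, ← hq, div_lt_div_iff₀ hpvpos hpupos]
  have hlt : -((Hess u z)⁻¹ i₀ i₀ * s) + 2 * t * q < 0 := by
    have h1 : (Hess u z)⁻¹ i₀ i₀ * s = t * (l * (Hess u z)⁻¹ i₀ i₀) := by rw [hs, ht]; ring
    have h2 : 2 * t * q = t * ((n : ℝ) + 2) := by rw [hq]; ring
    rw [h1, h2]
    nlinarith [mul_lt_mul_of_pos_left hb htpos]
  calc (Hess v z).det * (1 + ‖fderiv ℝ u z‖ ^ 2) ^ q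
      ≤ (Real.exp (-((Hess u z)⁻¹ i₀ i₀ * s)) * (Hess u z).det)
        * (Real.exp (2 * t * q) * (1 + ‖fderiv ℝ v z‖ ^ 2) ^ q) := by
        have := hpu.det_pos
        gcongr
    _ = Real.exp (-((Hess u z)⁻¹ i₀ i₀ * s) + 2 * t * q)
        * ((Hess u z).det * (1 + ‖fderiv ℝ v z‖ ^ 2) ^ q) := by
        rw [Real.exp_add]; ring
    _ < 1 * ((Hess u z).det * (1 + ‖fderiv ℝ v z‖ ^ 2) ^ q) :=
        mul_lt_mul_of_pos_right (Real.exp_lt_one_iff.2 hlt) (mul_pos hpu.det_pos hpvpos)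
    _ = _ := one_mul _

/-- Comparison principle for the Gauß curvature operator. -/
theorem le_of_gaussK_le (hn : 0 < n) {D O : Set (Euc n)} (hD : IsCompact D) (hO : IsOpen O)
    (hOD : O ⊆ D) {u v : Euc n → ℝ} (hcu : ContinuousOn u D) (hcv : ContinuousOn v D)
    (hu : ∀ x ∈ O, ContDiffAt ℝ 2 u x) (hv : ∀ x ∈ O, ContDiffAt ℝ 2 v x)
    (hpu : ∀ x ∈ O, (Hess u x).PosDef) (hpv : ∀ x ∈ O, (Hess v x).PosDef)
    (hbd : ∀ x ∈ D, x ∉ O → v x ≤ u x)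
    (hK : ∀ x ∈ O, u x < v x → gaussK u x ≤ gaussK v x) : ∀ x ∈ D, v x ≤ u x := by
  by_contra! hcon
  obtain ⟨y, hyD, hy⟩ := hcon
  let i₀ : Fin n := ⟨0, hn⟩
  set m := (u y - v y) / 2 with hm
  have hm0 : m < 0 := by rw [hm]; linarith
  have hcw : ContinuousOn (fun x => u x - v x) D := hcu.sub hcv
  set C := D ∩ (fun x => u x - v x) ⁻¹' Iic m with hC
  have hCcl : IsClosed C := hcw.preimage_isClosed_of_isClosed hD.isClosed isClosed_Iic
  have hCc : IsCompact C := hD.of_isClosed_subset hCcl inter_subset_left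
  have hCO : C ⊆ O := by
    intro x hx
    by_contra hxO
    have h1 := hbd x hx.1 hxO
    have h2 : u x - v x ≤ m := hx.2
    linarith
  have hyC : y ∈ C := ⟨hyD, by show u y - v y ≤ m; rw [hm]; linarith⟩
  have hbcont : ContinuousOn (fun x => (Hess u x)⁻¹ i₀ i₀) C := fun x hx =>
    (continuousAt_Hess_inv (hu x (hCO hx)) (hpu x (hCO hx)) i₀ i₀).continuousWithinAt
  obtain ⟨x₁, hx₁, hmin₁⟩ := hCc.exists_isMinOn ⟨y, hyC⟩ hbcont
  set b := (Hess u x₁)⁻¹ i₀ i₀ with hb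
  have hbpos : 0 < b := (hpu x₁ (hCO hx₁)).inv.diag_pos
  set l := ((n : ℝ) + 3) / b with hl
  have hlpos : 0 < l := by positivity
  have hφ : Continuous fun x : Euc n => Real.exp (l * x i₀) := by fun_prop
  obtain ⟨x₂, hx₂, hmax₂⟩ := hD.exists_isMaxOn ⟨y, hyD⟩ hφ.continuousOn
  set M := Real.exp (l * x₂ i₀) with hM
  have hMpos : 0 < M := Real.exp_pos _
  set η := -m / M with hη
  have hηpos : 0 < η := div_pos (neg_pos.2 hm0) hMpos
  obtain ⟨z, hz, hzmin⟩ := hD.exists_isMinOn ⟨y, hyD⟩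
    (hcw.sub (hφ.const_mul η).continuousOn)
  have hzC : z ∈ C := by
    refine ⟨hz, ?_⟩
    have h1 := hzmin hyD
    have h2 := hmax₂ hz
    simp only [mem_ofPred_eq, Pi.sub_apply] at h1 h2
    have h3 : η * M = -m := by rw [hη]; field_simp
    have h4 := mul_le_mul_of_nonneg_left h2 hηpos.le
    have h5 : 0 < η * Real.exp (l * y i₀) := by positivity
    show u z - v z ≤ m
    linarith
  have hzO := hCO hzC
  have hlt := gaussK_lt_of_isLocalMin hlpos hηpos (hu z hzO) (hv z hzO) (hpu z hzO) (hpv z hzO)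
    (i₀ := i₀) (by
      have h1 : b ≤ (Hess u z)⁻¹ i₀ i₀ := hmin₁ hzC
      have h2 : l * b = n + 3 := by rw [hl]; field_simp
      nlinarith [mul_le_mul_of_nonneg_left h1 hlpos.le])
    (hzmin.isLocalMin (mem_of_superset (hO.mem_nhds hzO) hOD))
  refine absurd (hK z hzO ?_) (not_le.2 hlt)
  have : u z - v z ≤ m := hzC.2
  linarith

end Comparison
section Setting

variable {n : ℕ}

theorem Euc.exists_norm_eq_one_inner_eq_zero (hn : 2 ≤ n) (y : Euc n) :
    ∃ e : Euc n, ‖e‖ = 1 ∧ ⟪y, e⟫ = 0 := by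
  have h1 : (Submodule.span ℝ {y})ᗮ ≠ ⊥ := by
    intro h
    rw [Submodule.orthogonal_eq_bot_iff] at h
    have h2 : Module.finrank ℝ (Submodule.span ℝ {y}) ≤ 1 :=
      (finrank_span_le_card (R := ℝ) ({y} : Set (Euc n))).trans_eq (by simp)
    rw [h, finrank_top, finrank_euclideanSpace_fin] at h2
    omega
  obtain ⟨w, hw, hw0⟩ := Submodule.exists_mem_ne_zero_of_ne_bot h1
  refine ⟨‖w‖⁻¹ • w, ?_, ?_⟩
  · rw [norm_smul, norm_inv, norm_norm, inv_mul_cancel₀ (norm_ne_zero_iff.2 hw0)]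
  · rw [inner_smul_right, Submodule.mem_orthogonal_singleton_iff_inner_right.1 hw, mul_zero]

theorem convexOn_line {D O : Set (Euc n)} {u : Euc n → ℝ} (hc : ContinuousOn u D)
    (hu : ∀ x ∈ O, ContDiffAt ℝ 2 u x) (hp : ∀ x ∈ O, (Hess u x).PosDef) {x v : Euc n} {a b : ℝ}
    (hD : ∀ t ∈ Icc a b, x + t • v ∈ D) (hO : ∀ t ∈ Ioo a b, x + t • v ∈ O) :
    ConvexOn ℝ (Icc a b) fun t => u (x + t • v) := by
  rcases eq_or_ne v 0 with rfl | hv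
  · simpa using convexOn_const (u x) (convex_Icc a b)
  refine convexOn_of_hasDerivWithinAt2_nonneg (convex_Icc a b)
    (f' := fun t => fderiv ℝ u (x + t • v) v)
    (f'' := fun t => iteratedFDeriv ℝ 2 u (x + t • v) ![v, v])
    (hc.comp (by fun_prop) hD) ?_ ?_ ?_ <;> rw [interior_Icc] <;> intro t ht
  · exact (hu _ (hO t ht)).hasDerivAt_line.hasDerivWithinAt
  · exact (hu _ (hO t ht)).hasDerivAt_fderiv_line.hasDerivWithinAt
  · exact (iteratedFDeriv_two_pos (hp _ (hO t ht)) hv).le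

theorem fderiv_norm_le_one (x : Euc n) : ‖fderiv ℝ (fun y : Euc n => ‖y‖) x‖ ≤ 1 := by
  simpa using norm_fderiv_le_of_lipschitz ℝ (x₀ := x) (lipschitzWith_one_norm (E := Euc n))

variable (S : ExtSetting n)

theorem ExtSetting.n_pos {n : ℕ} (S : ExtSetting n) : 0 < n := by have := S.hn; omega

theorem ExtSetting.isOpen_ball_diff (R : ℝ) : IsOpen (ball (0 : Euc n) R \ S.K) :=
  isOpen_ball.sdiff S.hKc.isClosed

theorem ExtSetting.ball_diff_subset (R : ℝ) : ball (0 : Euc n) R \ S.K ⊆ solDom S R :=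
  fun _ hx => ⟨ball_subset_closedBall hx.1, fun h => hx.2 (interior_subset h)⟩

theorem ExtSetting.solDom_mem_nhds {R : ℝ} {x : Euc n} (hx : x ∈ ball (0 : Euc n) R \ S.K) :
    solDom S R ∈ 𝓝 x :=
  mem_of_superset ((S.isOpen_ball_diff R).mem_nhds hx) (S.ball_diff_subset R)

theorem ExtSetting.notMem_K {x : Euc n} (hx : S.R₀ ≤ ‖x‖) : x ∉ S.K := fun h => by
  have := S.hKR₀ h
  rw [mem_ball_zero_iff] at this
  linarith

theorem ExtSetting.mem_ball_diff {R : ℝ} {x : Euc n} (hx : S.R₀ ≤ ‖x‖) (hxR : ‖x‖ < R) :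
    x ∈ ball (0 : Euc n) R \ S.K :=
  ⟨by simpa using hxR, S.notMem_K hx⟩

theorem ExtSetting.mem_solDom {R : ℝ} {x : Euc n} (hx : S.R₀ ≤ ‖x‖) (hxR : ‖x‖ ≤ R) :
    x ∈ solDom S R :=
  ⟨by simpa using hxR, fun h => S.notMem_K hx (interior_subset h)⟩

theorem ExtSetting.contDiffAt_ul {x : Euc n} (hx : x ∉ S.K) : ContDiffAt ℝ 2 S.ul x := by
  have h : (interior S.K)ᶜ ∈ 𝓝 x := mem_of_superset (S.hKc.isClosed.isOpen_compl.mem_nhds hx)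
    (compl_subset_compl.2 interior_subset)
  exact (S.hulsm.contDiffAt h).of_le (WithTop.coe_le_coe.2 (le_top : (2 : ℕ∞) ≤ ⊤))

theorem ExtSetting.isCompact_solDom (R : ℝ) : IsCompact (solDom S R) :=
  (isCompact_closedBall 0 R).diff isOpen_interior

variable {S} {R : ℝ} {u : Euc n → ℝ}

theorem IsSol.contDiffAt (hu : IsSol S R u) {x : Euc n} (hx : x ∈ ball (0 : Euc n) R \ S.K) :
    ContDiffAt ℝ 2 u x :=
  (hu.1.contDiffAt (S.solDom_mem_nhds hx)).of_le (WithTop.coe_le_coe.2 (le_top : (2 : ℕ∞) ≤ ⊤))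

theorem IsSol.ul_le (hu : IsSol S R u) : ∀ x ∈ solDom S R, S.ul x ≤ u x := by
  refine le_of_gaussK_le S.n_pos (S.isCompact_solDom R) (S.isOpen_ball_diff R)
    (S.ball_diff_subset R) hu.1.continuousOn
    (S.hulsm.continuousOn.mono fun x hx => hx.2) (fun x hx => hu.contDiffAt hx)
    (fun x hx => S.contDiffAt_ul hx.2) hu.2.1 (fun x hx => S.hulconv x hx.2) ?_ ?_
  · intro x hx hxO
    refine (hu.2.2.2 x ?_).ge
    by_cases hxK : x ∈ S.K
    · exact Or.inr ⟨subset_closure hxK, hx.2⟩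
    · left
      have h1 : ¬ ‖x‖ < R := fun h => hxO ⟨by simpa using h, hxK⟩
      have h2 : ‖x‖ ≤ R := by simpa using hx.1
      simpa using le_antisymm h2 (not_lt.1 h1)
  · intro x hx hlt
    rw [hu.2.2.1 x hx]
    exact (S.hfz x (fun h => hx.2 (interior_subset h)) hlt.le).trans (S.hulsub x hx.2)

theorem IsSol.le_add_of_cone (hu : IsSol S R u) {C : ℝ}
    (hC : ∀ x ∈ (interior S.K)ᶜ, |S.ul x - ‖x‖| ≤ C) {y : Euc n}
    (hy : S.R₀ ≤ ‖y‖) (hyR : ‖y‖ ≤ R) : u y ≤ R + C := by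
  obtain ⟨e, he, hye⟩ := Euc.exists_norm_eq_one_inner_eq_zero S.hn y
  have hnorm : ∀ t : ℝ, ‖y + t • e‖ ^ 2 = ‖y‖ ^ 2 + t ^ 2 := fun t => by
    rw [norm_add_sq_real, inner_smul_right, hye, norm_smul, he, Real.norm_eq_abs, mul_one, sq_abs]
    ring
  have hR : 0 ≤ R := (norm_nonneg y).trans hyR
  set s := √(R ^ 2 - ‖y‖ ^ 2) with hs
  have hs0 : 0 ≤ s := Real.sqrt_nonneg _
  have hs2 : s ^ 2 = R ^ 2 - ‖y‖ ^ 2 :=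
    Real.sq_sqrt (by nlinarith [norm_nonneg y])
  have hlow : ∀ t : ℝ, S.R₀ ≤ ‖y + t • e‖ := fun t =>
    hy.trans (le_of_sq_le_sq (by rw [hnorm]; nlinarith [sq_nonneg t]) (norm_nonneg _))
  have hend : ∀ t : ℝ, t ^ 2 = s ^ 2 → u (y + t • e) ≤ R + C := by
    intro t ht
    have h1 : ‖y + t • e‖ = R :=
      (sq_eq_sq₀ (norm_nonneg _) hR).1 (by rw [hnorm, ht, hs2]; ring)
    have h2 := hC (y + t • e) fun h => S.notMem_K (hlow t) (interior_subset h)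
    rw [hu.2.2.2 _ (Or.inl (by simpa using h1))]
    rw [h1] at h2
    linarith [(abs_le.1 h2).2]
  have hconv : ConvexOn ℝ (Icc (-s) s) fun t => u (y + t • e) := by
    refine convexOn_line hu.1.continuousOn (fun x hx => hu.contDiffAt hx) hu.2.1 ?_ ?_
    · intro t ht
      have : t ^ 2 ≤ s ^ 2 := sq_le_sq' ht.1 ht.2
      exact S.mem_solDom (hlow t) (le_of_sq_le_sq (by rw [hnorm]; linarith) hR)
    · intro t ht
      have : t ^ 2 < s ^ 2 := sq_lt_sq' ht.1 ht.2
      exact S.mem_ball_diff (hlow t) (lt_of_pow_lt_pow_left₀ 2 hR (by rw [hnorm]; linarith))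
  have h0 := hconv.le_max_of_mem_Icc (x := -s) (y := s) (z := 0) ⟨le_rfl, by linarith⟩
    ⟨by linarith, le_rfl⟩ ⟨by linarith, hs0⟩
  have h1 : u y ≤ max (u (y + (-s) • e)) (u (y + s • e)) := by simpa using h0
  exact h1.trans (max_le (hend _ (by ring)) (hend _ rfl))

variable (S) in
theorem ExtSetting.exists_norm_fderiv_ul_sub_le : ∃ C R₁ : ℝ, 0 < C ∧ 1 ≤ R₁ ∧ S.R₀ ≤ R₁ ∧
    ∀ x : Euc n, R₁ ≤ ‖x‖ → ‖fderiv ℝ (fun y => S.ul y - ‖y‖) x‖ ≤ C ∧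
      ‖fderiv ℝ S.ul x‖ ≤ C := by
  obtain ⟨C, R₁, h⟩ := S.huldec1
  refine ⟨|C| + 1, max R₁ (max 1 S.R₀), by positivity, by simp, by simp, fun x hx => ?_⟩
  simp only [max_le_iff] at hx
  obtain ⟨hx1, hx2, hx3⟩ := hx
  have h1 : ‖fderiv ℝ (fun y => S.ul y - ‖y‖) x‖ ≤ |C| := by
    refine (h x hx1).trans ?_
    rw [div_le_iff₀ (by linarith)]
    nlinarith [le_abs_self C, abs_nonneg C]
  refine ⟨by linarith, ?_⟩
  have hx0 : x ≠ 0 := norm_pos_iff.1 (by linarith)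
  have hd := (S.contDiffAt_ul (S.notMem_K hx3)).differentiableAt (by norm_num)
  have hd' : DifferentiableAt ℝ (fun y : Euc n => ‖y‖) x :=
    (contDiffAt_norm ℝ (n := 1) hx0).differentiableAt (by norm_num)
  have h2 : fderiv ℝ S.ul x
      = fderiv ℝ (fun y => S.ul y - ‖y‖) x + fderiv ℝ (fun y : Euc n => ‖y‖) x := by
    rw [fderiv_fun_sub hd hd']; abel
  rw [h2]
  exact (norm_add_le _ _).trans (add_le_add h1 (fderiv_norm_le_one x))

/-- A ray of length `R / 2` starting in the ball is cut off at the sphere of radius `R`. -/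
theorem exists_exit_time {x v : Euc n} (hR : 0 < R) (hx : ‖x‖ < R) :
    ∃ T : ℝ, 0 < T ∧ T ≤ R / 2 ∧ ‖x + T • v‖ ≤ R ∧ (T = R / 2 ∨ ‖x + T • v‖ = R) := by
  by_cases h : ‖x + (R / 2) • v‖ ≤ R
  · exact ⟨R / 2, by positivity, le_rfl, h, Or.inl rfl⟩
  · have hc : ContinuousOn (fun t : ℝ => ‖x + t • v‖) (Icc 0 (R / 2)) := by fun_prop
    obtain ⟨T, hT, hTR⟩ := intermediate_value_Icc (by positivity) hc
      (show R ∈ Icc _ _ from ⟨by simpa using hx.le, (not_le.1 h).le⟩)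
    refine ⟨T, lt_of_le_of_ne hT.1 ?_, hT.2, hTR.le, Or.inr hTR⟩
    rintro rfl
    simp at hTR
    linarith

variable (S) in
theorem ExtSetting.exists_norm_fderiv_le : ∃ C R₁ : ℝ, 0 < C ∧ ∀ R : ℝ, 4 * S.R₀ < R → R₁ ≤ R →
    ∀ u : Euc n → ℝ, IsSol S R u → ∀ x : Euc n, 3 * R / 4 ≤ ‖x‖ → ‖x‖ < R →
      ‖fderiv ℝ u x‖ ≤ C := by
  obtain ⟨C₀, hC₀⟩ := S.hulcone
  obtain ⟨C, R₁, hC, hR₁, hR₁', hD⟩ := S.exists_norm_fderiv_ul_sub_le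
  refine ⟨C + 1, max (4 * R₁) (8 * C₀), by positivity, fun R hR0 hR u hu x hx hxR => ?_⟩
  obtain ⟨hRa, hRb⟩ := max_le_iff.1 hR
  have hRpos : 0 < R := by linarith
  have hdir : ∀ v : Euc n, ‖v‖ = 1 → fderiv ℝ u x v ≤ C + 1 := by
    intro v hv
    obtain ⟨T, hT0, hTR, hTn, hT⟩ := exists_exit_time (v := v) hRpos hxR
    have hlow : ∀ t ∈ Icc 0 T, R / 4 ≤ ‖x + t • v‖ := by
      intro t ht
      have h1 : ‖x‖ ≤ ‖x + t • v‖ + ‖t • v‖ := by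
        simpa using norm_sub_le (x + t • v) (t • v)
      rw [norm_smul, hv, mul_one, Real.norm_of_nonneg ht.1] at h1
      linarith [ht.2]
    have hseg : ∀ t ∈ Icc 0 T, x + t • v = (1 - t / T) • x + (t / T) • (x + T • v) := by
      intro t _
      rw [smul_add, smul_smul, div_mul_cancel₀ _ hT0.ne', ← add_assoc, ← add_smul]
      simp
    have hup : ∀ t ∈ Icc 0 T, ‖x + t • v‖ ≤ (1 - t / T) * ‖x‖ + (t / T) * R := by
      intro t ht
      have h1 : 0 ≤ t / T := div_nonneg ht.1 hT0.le
      have h2 : t / T ≤ 1 := (div_le_one hT0).2 ht.2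
      rw [hseg t ht]
      refine (norm_add_le _ _).trans ?_
      rw [norm_smul, norm_smul, Real.norm_of_nonneg h1, Real.norm_of_nonneg (by linarith)]
      gcongr
    have hconv : ConvexOn ℝ (Icc 0 T) fun t => u (x + t • v) := by
      refine convexOn_line hu.1.continuousOn (fun x hx => hu.contDiffAt hx) hu.2.1 ?_ ?_
      · intro t ht
        have h2 : t / T ≤ 1 := (div_le_one hT0).2 ht.2
        refine S.mem_solDom (by linarith [hlow t ht]) ((hup t ht).trans ?_)
        nlinarith
      · intro t ht
        have h2 : t / T < 1 := (div_lt_one hT0).2 ht.2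
        have ht' := Ioo_subset_Icc_self ht
        refine S.mem_ball_diff (by linarith [hlow t ht']) ((hup t ht').trans_lt ?_)
        nlinarith
    have hxO : x ∈ ball (0 : Euc n) R \ S.K := S.mem_ball_diff (by linarith) hxR
    have hder := ContDiffAt.hasDerivAt_line (x := x) (v := v) (t := 0)
      (by simpa using hu.contDiffAt hxO)
    have hslope := hconv.le_slope_of_hasDerivAt (x := 0) (y := T) ⟨le_rfl, hT0.le⟩
      ⟨hT0.le, le_rfl⟩ hT0 hder
    rw [slope_def_field, le_div_iff₀ (by linarith)] at hslope
    simp only [zero_smul, add_zero, sub_zero] at hslope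
    have hux := hu.ul_le x (S.mem_solDom (by linarith) hxR.le)
    suffices u (x + T • v) - u x ≤ (C + 1) * T from
      le_of_mul_le_mul_right (hslope.trans this) hT0
    rcases hT with hT | hT
    · have h1 := hu.le_add_of_cone hC₀ (y := x + T • v)
        (by linarith [hlow T ⟨hT0.le, le_rfl⟩]) hTn
      have h2 := hC₀ x fun h => hxO.2 (interior_subset h)
      have h3 := (abs_le.1 h2).1
      rw [hT] at h1 ⊢
      nlinarith
    · rw [hu.2.2.2 _ (Or.inl (by simpa using hT))]
      have hsub : ∀ z ∈ segment ℝ x (x + T • v), R / 4 ≤ ‖z‖ := by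
        intro z hz
        rw [segment_eq_image'] at hz
        obtain ⟨θ, hθ, rfl⟩ := hz
        have := hlow (θ * T) ⟨mul_nonneg hθ.1 hT0.le, by nlinarith [hθ.2]⟩
        simpa [mul_smul] using this
      have h1 := (convex_segment x (x + T • v)).norm_image_sub_le_of_norm_fderiv_le
        (𝕜 := ℝ) (f := S.ul) (C := C)
        (fun z hz => (S.contDiffAt_ul (S.notMem_K (by linarith [hsub z hz]))).differentiableAt
          (by norm_num))
        (fun z hz => (hD z (by linarith [hsub z hz])).2)
        (left_mem_segment ℝ _ _) (right_mem_segment ℝ _ _)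
      rw [add_sub_cancel_left, norm_smul, hv, mul_one, Real.norm_of_nonneg hT0.le] at h1
      have h2 := (le_abs_self _).trans h1
      linarith
  refine ContinuousLinearMap.opNorm_le_of_unit_norm (by positivity) fun v hv => ?_
  rw [Real.norm_eq_abs, abs_le]
  have h1 := hdir v hv
  have h2 := hdir (-v) (by rwa [norm_neg])
  rw [map_neg] at h2
  exact ⟨by linarith, h1⟩

variable (S) in
theorem ExtSetting.exists_det_Hess_le : ∃ C R₁ : ℝ, 0 < C ∧ ∀ R : ℝ, 4 * S.R₀ < R → R₁ ≤ R →
    ∀ u : Euc n → ℝ, IsSol S R u → ∀ x : Euc n, 3 * R / 4 ≤ ‖x‖ → ‖x‖ < R →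
      (Hess u x).det * R ^ (n + 1) ≤ C := by
  obtain ⟨Cf, hCf⟩ := S.hfdec
  obtain ⟨C, R₁, hC, hD⟩ := S.exists_norm_fderiv_le
  refine ⟨(1 + C ^ 2) ^ (((n : ℝ) + 2) / 2) * ((|Cf| + 1) * 2 ^ (n + 1)), R₁, by positivity,
    fun R hR0 hR u hu x hx hxR => ?_⟩
  have hR0' := S.hR₀
  have hRpos : 0 < R := by linarith
  have hxO : x ∈ ball (0 : Euc n) R \ S.K := S.mem_ball_diff (by linarith) hxR
  have hxI : x ∈ (interior S.K)ᶜ := fun h => hxO.2 (interior_subset h)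
  have hgrad := hD R hR0 hR u hu x hx hxR
  have hp : 0 < (1 + ‖fderiv ℝ u x‖ ^ 2) ^ (((n : ℝ) + 2) / 2) := by positivity
  have hK := hu.2.2.1 x hxO
  rw [gaussK, div_eq_iff hp.ne'] at hK
  have hf := S.hfpos x hxI (u x)
  have hfR : S.f x (u x) * R ^ (n + 1) ≤ (|Cf| + 1) * 2 ^ (n + 1) := by
    have h1 : R ^ (n + 1) ≤ (‖x‖ * 2) ^ (n + 1) := pow_le_pow_left₀ hRpos.le (by linarith) _
    rw [mul_pow] at h1
    have h2 := hCf x hxI (u x)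
    calc S.f x (u x) * R ^ (n + 1) ≤ S.f x (u x) * (‖x‖ ^ (n + 1) * 2 ^ (n + 1)) := by gcongr
      _ = S.f x (u x) * ‖x‖ ^ (n + 1) * 2 ^ (n + 1) := by ring
      _ ≤ _ := by
        gcongr
        linarith [le_abs_self Cf]
  rw [hK]
  calc S.f x (u x) * (1 + ‖fderiv ℝ u x‖ ^ 2) ^ (((n : ℝ) + 2) / 2) * R ^ (n + 1)
      = (1 + ‖fderiv ℝ u x‖ ^ 2) ^ (((n : ℝ) + 2) / 2) * (S.f x (u x) * R ^ (n + 1)) := by ring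
    _ ≤ _ := by gcongr

end Setting
section Barrier

variable {n : ℕ}

theorem hasDerivAt_norm_line {x v : Euc n} {t : ℝ} (h : x + t • v ≠ 0) :
    HasDerivAt (fun t : ℝ => ‖x + t • v‖) (⟪x + t • v, v⟫ / ‖x + t • v‖) t := by
  have h0 : 0 < ‖x + t • v‖ := norm_pos_iff.2 h
  have h1 := ((hasDerivAt_line x v t).norm_sq).sqrt (by positivity)
  simp only [Real.sqrt_sq (norm_nonneg _)] at h1
  refine h1.congr_deriv ?_
  field_simp

theorem hasDerivAt_inner_div_norm_line {x v : Euc n} (h : x ≠ 0) :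
    HasDerivAt (fun t : ℝ => ⟪x + t • v, v⟫ / ‖x + t • v‖)
      ((‖v‖ ^ 2 - (⟪x, v⟫ / ‖x‖) ^ 2) / ‖x‖) 0 := by
  have h0 : ‖x‖ ≠ 0 := norm_ne_zero_iff.2 h
  have h1 := hasDerivAt_norm_line (x := x) (v := v) (t := 0) (by simpa using h)
  have h2 := (hasDerivAt_line x v 0).inner ℝ (hasDerivAt_const (0 : ℝ) v)
  have h3 := h2.div h1 (by simpa using h0)
  refine h3.congr_deriv ?_
  simp only [zero_smul, add_zero, inner_zero_right, zero_add, real_inner_self_eq_norm_sq]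
  field_simp

/-- The barrier function with general coefficients in place of the powers of `R`. -/
def barrierFun (R a b : ℝ) (u w : Euc n → ℝ) (x : Euc n) : ℝ :=
  (u x - w x) + a * (R - ‖x‖) - 1 / 2 * b * (R - ‖x‖) ^ 2

variable {R a b : ℝ} {u w : Euc n → ℝ} {x : Euc n}

theorem contDiffAt_barrierFun (hu : ContDiffAt ℝ 2 u x) (hw : ContDiffAt ℝ 2 w x) (hx : x ≠ 0) :
    ContDiffAt ℝ 2 (barrierFun R a b u w) x := by
  have hd : ContDiffAt ℝ 2 (fun y : Euc n => R - ‖y‖) x :=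
    contDiffAt_const.sub (contDiffAt_norm ℝ hx)
  exact ((hu.sub hw).add (contDiffAt_const.mul hd)).sub (contDiffAt_const.mul (hd.pow 2))

theorem hasDerivAt_barrierFun_line {v : Euc n} {t : ℝ} (hu : ContDiffAt ℝ 2 u (x + t • v))
    (hw : ContDiffAt ℝ 2 w (x + t • v)) (hx : x + t • v ≠ 0) :
    HasDerivAt (fun t => barrierFun R a b u w (x + t • v))
      (fderiv ℝ u (x + t • v) v - fderiv ℝ w (x + t • v) v
        - (a - b * (R - ‖x + t • v‖)) * (⟪x + t • v, v⟫ / ‖x + t • v‖)) t := by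
  have hd := (hasDerivAt_norm_line hx).const_sub R
  have h := ((hu.hasDerivAt_line.sub hw.hasDerivAt_line).add (hd.const_mul a)).sub
    ((hd.pow 2).const_mul (1 / 2 * b))
  refine h.congr_deriv ?_
  simp
  ring

theorem fderiv_barrierFun (hu : ContDiffAt ℝ 2 u x) (hw : ContDiffAt ℝ 2 w x) (hx : x ≠ 0)
    (v : Euc n) : fderiv ℝ (barrierFun R a b u w) x v
      = fderiv ℝ u x v - fderiv ℝ w x v - (a - b * (R - ‖x‖)) * (⟪x, v⟫ / ‖x‖) := by
  have h1 := ContDiffAt.hasDerivAt_line (t := 0) (v := v)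
    (by simpa using contDiffAt_barrierFun (R := R) (a := a) (b := b) hu hw hx)
  have h2 := hasDerivAt_barrierFun_line (t := 0) (v := v) (R := R) (a := a) (b := b)
    (by simpa using hu) (by simpa using hw) (by simpa using hx)
  simpa using h1.unique h2

theorem iteratedFDeriv_barrierFun (hu : ContDiffAt ℝ 2 u x) (hw : ContDiffAt ℝ 2 w x)
    (hx : x ≠ 0) (v : Euc n) : iteratedFDeriv ℝ 2 (barrierFun R a b u w) x ![v, v]
      = iteratedFDeriv ℝ 2 u x ![v, v] - iteratedFDeriv ℝ 2 w x ![v, v]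
        - (a - b * (R - ‖x‖)) * ((‖v‖ ^ 2 - (⟪x, v⟫ / ‖x‖) ^ 2) / ‖x‖)
        - b * (⟪x, v⟫ / ‖x‖) ^ 2 := by
  refine (contDiffAt_barrierFun hu hw hx).iteratedFDeriv_two_eq
    (g' := fun t => fderiv ℝ u (x + t • v) v - fderiv ℝ w (x + t • v) v
        - (a - b * (R - ‖x + t • v‖)) * (⟪x + t • v, v⟫ / ‖x + t • v‖)) ?_ ?_
  · filter_upwards [eventually_line v (hu.eventually (by simp)),
      eventually_line v (hw.eventually (by simp)),
      eventually_line v (isOpen_ne.mem_nhds hx)] with t h1 h2 h3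
    exact hasDerivAt_barrierFun_line h1 h2 h3
  · have h1 := ContDiffAt.hasDerivAt_fderiv_line (t := 0) (v := v) (by simpa using hu)
    have h2 := ContDiffAt.hasDerivAt_fderiv_line (t := 0) (v := v) (by simpa using hw)
    have h3 := hasDerivAt_inner_div_norm_line (v := v) hx
    have h4 := hasDerivAt_norm_line (x := x) (v := v) (t := 0) (by simpa using hx)
    have h5 := ((h4.const_sub R).const_mul b).const_sub a
    have h := (h1.sub h2).sub (h5.mul h3)
    refine h.congr_deriv ?_
    simp
    ring

theorem iteratedFDeriv_sub_norm (hw : ContDiffAt ℝ 2 w x) (hx : x ≠ 0) (v : Euc n) :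
    iteratedFDeriv ℝ 2 (fun y => w y - ‖y‖) x ![v, v]
      = iteratedFDeriv ℝ 2 w x ![v, v] - (‖v‖ ^ 2 - (⟪x, v⟫ / ‖x‖) ^ 2) / ‖x‖ := by
  have h := iteratedFDeriv_barrierFun (R := 0) (a := 1) (b := 0) (w := fun _ => 0) hw
    contDiffAt_const hx v
  have h0 : iteratedFDeriv ℝ 2 (fun _ : Euc n => (0 : ℝ)) x = 0 := by
    exact congrFun (iteratedFDeriv_fun_zero (𝕜 := ℝ) (E := Euc n) (F := ℝ) (n := 2)) x
  have h1 : barrierFun 0 1 0 w (fun _ => 0) = fun y => w y - ‖y‖ := by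
    ext y; simp [barrierFun]; ring
  rw [h1, h0] at h
  simpa using h

/-- A lower bound for the tangential and radial parts of the Hessian of the barrier. -/
def radialMatrix (α β : ℝ) (ν : Euc n) : Matrix (Fin n) (Fin n) ℝ :=
  α • (1 : Matrix (Fin n) (Fin n) ℝ) + (β - α) • Matrix.vecMulVec ν ν

theorem Euc.inner_eq_sum (x y : Euc n) : ⟪x, y⟫ = ∑ i, x i * y i := by
  simp [PiLp.inner_apply, mul_comm]

theorem sum_one (v : Euc n) :
    ∑ i, ∑ j, v i * v j * (1 : Matrix (Fin n) (Fin n) ℝ) i j = ‖v‖ ^ 2 := by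
  rw [EuclideanSpace.real_norm_sq_eq]
  simp [Matrix.one_apply, sq]

theorem sum_vecMulVec (ν v : Euc n) :
    ∑ i, ∑ j, v i * v j * Matrix.vecMulVec ν ν i j = ⟪ν, v⟫ ^ 2 := by
  rw [Euc.inner_eq_sum, sq, Finset.sum_mul_sum]
  refine Finset.sum_congr rfl fun i _ => Finset.sum_congr rfl fun j _ => ?_
  rw [Matrix.vecMulVec_apply]
  ring

theorem sum_radialMatrix (α β : ℝ) (ν v : Euc n) :
    ∑ i, ∑ j, v i * v j * radialMatrix α β ν i j = α * ‖v‖ ^ 2 + (β - α) * ⟪ν, v⟫ ^ 2 := by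
  rw [← sum_one, ← sum_vecMulVec]
  simp only [radialMatrix, Matrix.add_apply, Matrix.smul_apply, smul_eq_mul, mul_add,
    Finset.sum_add_distrib, Finset.mul_sum]
  congr 1 <;>
    exact Finset.sum_congr rfl fun i _ => Finset.sum_congr rfl fun j _ => by ring

theorem radialMatrix_symm (α β : ℝ) (ν : Euc n) (i j : Fin n) :
    radialMatrix α β ν i j = radialMatrix α β ν j i := by
  simp [radialMatrix, Matrix.vecMulVec_apply, Matrix.one_apply, eq_comm, mul_comm]

theorem inner_sq_le_of_norm_eq_one {ν : Euc n} (hν : ‖ν‖ = 1) (v : Euc n) :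
    ⟪ν, v⟫ ^ 2 ≤ ‖v‖ ^ 2 := by
  have := abs_real_inner_le_norm ν v
  rw [hν, one_mul] at this
  exact sq_le_sq' (by linarith [neg_abs_le ⟪ν, v⟫]) ((le_abs_self _).trans this)

theorem posSemidef_radialMatrix_sub {α β : ℝ} (hβα : β ≤ α) {ν : Euc n} (hν : ‖ν‖ = 1) :
    (radialMatrix α β ν - β • (1 : Matrix (Fin n) (Fin n) ℝ)).PosSemidef := by
  refine Matrix.posSemidef_of_sum (fun i j => ?_) fun v => ?_
  · simp [radialMatrix_symm α β ν i j, Matrix.one_apply, eq_comm]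
  · have h1 := sum_radialMatrix α β ν (WithLp.toLp 2 v)
    have h2 := sum_one (WithLp.toLp 2 v)
    have h3 := inner_sq_le_of_norm_eq_one hν (WithLp.toLp 2 v)
    simp only [Matrix.sub_apply, Matrix.smul_apply, smul_eq_mul, mul_sub, Finset.sum_sub_distrib,
      mul_left_comm _ β, ← Finset.mul_sum]
    dsimp only at h1 h2
    rw [h1, h2]
    nlinarith

theorem det_radialMatrix {α β : ℝ} (hα : α ≠ 0) {ν : Euc n} (hν : ‖ν‖ = 1) :
    (radialMatrix α β ν).det = α ^ n * (β / α) := by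
  have h1 : radialMatrix α β ν = α • (1 + Matrix.replicateCol Unit (((β - α) / α) • ν.ofLp) *
      Matrix.replicateRow Unit ν.ofLp) := by
    ext i j
    simp [radialMatrix, Matrix.vecMulVec_apply, Matrix.mul_apply, Matrix.replicateCol,
      Matrix.replicateRow]
    field_simp
  have h2 : ν.ofLp ⬝ᵥ ν.ofLp = 1 := by
    have := EuclideanSpace.real_norm_sq_eq ν
    rw [hν] at this
    simp only [dotProduct, ← sq]
    rw [← this]; norm_num
  rw [h1, Matrix.det_smul, Matrix.det_one_add_replicateCol_mul_replicateRow, dotProduct_smul, h2,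
    Fintype.card_fin, smul_eq_mul]
  field_simp
  ring

/-- Boundedness of the first order terms of the linearized operator. -/
theorem neg_first_order_le {p c : Fin n → ℝ} {C : ℝ} (hc : ∀ i, |c i| ≤ C) :
    -(((n : ℝ) + 2) / (1 + ∑ i, p i ^ 2) * ∑ i, p i * (p i - c i)) ≤ ((n : ℝ) + 2) * (n * C) := by
  set P := ∑ i, p i ^ 2 with hP
  have hP0 : 0 ≤ P := Finset.sum_nonneg fun i _ => sq_nonneg _
  have h1 : ∀ i, -(p i * (p i - c i)) ≤ (1 + P) * C := by
    intro i
    have h2 : p i ^ 2 ≤ P :=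
      Finset.single_le_sum (f := fun i => p i ^ 2) (fun i _ => sq_nonneg _) (Finset.mem_univ i)
    have h3 : p i * c i ≤ |p i| * C := by
      calc p i * c i ≤ |p i * c i| := le_abs_self _
        _ = |p i| * |c i| := abs_mul _ _
        _ ≤ _ := by gcongr; exact hc i
    have h4 : |p i| ≤ 1 + P := by nlinarith [sq_abs (p i), sq_nonneg (|p i| - 1)]
    have h5 : 0 ≤ C := (abs_nonneg _).trans (hc i)
    nlinarith [mul_le_mul_of_nonneg_right h4 h5, sq_nonneg (p i)]
  have h6 : -∑ i, p i * (p i - c i) ≤ n * ((1 + P) * C) := by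
    rw [← Finset.sum_neg_distrib]
    refine (Finset.sum_le_sum fun i _ => h1 i).trans ?_
    simp
  rw [← mul_neg, div_mul_eq_mul_div, div_le_iff₀ (by positivity)]
  have h7 := mul_le_mul_of_nonneg_left h6 (by positivity : (0 : ℝ) ≤ n + 2)
  calc _ ≤ _ := h7
    _ = _ := by ring

end Barrier

section PointwiseEstimate

variable {n : ℕ}

theorem Matrix.PosDef.trace_inv_mul_le {H A T : Matrix (Fin n) (Fin n) ℝ} (hH : H.PosDef) {c : ℝ}
    (hM : (H + c • (1 : Matrix (Fin n) (Fin n) ℝ) - A - T).PosSemidef) :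
    (H⁻¹ * T).trace ≤ n + c * H⁻¹.trace - (H⁻¹ * A).trace := by
  have h := hH.inv.posSemidef.trace_mul_nonneg hM
  have h1 : H⁻¹ * H = 1 := Matrix.nonsing_inv_mul _ hH.det_pos.ne'.isUnit
  simp only [mul_sub, mul_add, h1, Matrix.trace_sub, Matrix.trace_add, Matrix.mul_smul, mul_one,
    Matrix.trace_smul, Matrix.trace_one, Fintype.card_fin, smul_eq_mul] at h
  linarith

theorem mul_trace_inv_le_trace_mul_radialMatrix {H : Matrix (Fin n) (Fin n) ℝ} (hH : H.PosDef)
    {α β : ℝ} (hβα : β ≤ α) {ν : Euc n} (hν : ‖ν‖ = 1) :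
    β * H⁻¹.trace ≤ (H⁻¹ * radialMatrix α β ν).trace := by
  have h := hH.inv.posSemidef.trace_mul_nonneg (posSemidef_radialMatrix_sub hβα hν)
  simp only [mul_sub, Matrix.trace_sub, Matrix.mul_smul, mul_one, Matrix.trace_smul,
    smul_eq_mul] at h
  linarith

theorem posSemidef_radialMatrix {α β : ℝ} (hβ : 0 ≤ β) (hβα : β ≤ α) {ν : Euc n} (hν : ‖ν‖ = 1) :
    (radialMatrix α β ν).PosSemidef := by
  have h := (posSemidef_radialMatrix_sub hβα hν).add
    ((Matrix.PosSemidef.one (n := Fin n) (R := ℝ)).smul hβ)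
  simpa using h

theorem rpow_le_trace_mul_radialMatrix {H : Matrix (Fin n) (Fin n) ℝ} (hH : H.PosDef) (hn : 0 < n)
    {R b C : ℝ} (hR : 0 < R) (hb : 0 ≤ b) (hbR : b ≤ R⁻¹) {ν : Euc n} (hν : ‖ν‖ = 1)
    (hC : 0 < C) (hdet : H.det * R ^ (n + 1) ≤ C) :
    n * (R ^ 2 * b / C) ^ (1 / (n : ℝ)) ≤ (H⁻¹ * radialMatrix R⁻¹ b ν).trace := by
  have : Nonempty (Fin n) := ⟨⟨0, hn⟩⟩
  have hn0 : (0 : ℝ) < n := by exact_mod_cast hn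
  have hA := posSemidef_radialMatrix hb hbR hν
  have h := hH.inv.posSemidef.det_mul_le_trace_div_pow hA
  rw [Fintype.card_fin, det_radialMatrix (by positivity) hν, Matrix.det_nonsing_inv,
    Ring.inverse_eq_inv'] at h
  have ht := div_nonneg (hH.inv.posSemidef.trace_mul_nonneg hA) hn0.le
  have hd := hH.det_pos
  have h1 : R ^ 2 * b / C ≤ H.det⁻¹ * (R⁻¹ ^ n * (b / R⁻¹)) := by
    rw [div_le_iff₀ hC]
    have h2 : 0 ≤ H.det⁻¹ * (R⁻¹ ^ n * (b / R⁻¹)) := by positivity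
    have h3 := mul_le_mul_of_nonneg_left hdet h2
    refine le_trans (le_of_eq ?_) h3
    rw [inv_pow]
    field_simp
    ring
  have h4 := Real.rpow_le_rpow (by positivity) (h1.trans h) (by positivity : 0 ≤ 1 / (n : ℝ))
  rw [one_div, Real.pow_rpow_inv_natCast ht hn.ne', le_div_iff₀ hn0] at h4
  rw [one_div]
  linarith

theorem Llin_barrierFun_le {s : Set (Euc n)} {u w : Euc n → ℝ} {x : Euc n} (hs : s ∈ 𝓝 x)
    (hn : 0 < n) (hu : ContDiffAt ℝ 2 u x) (hw : ContDiffAt ℝ 2 w x) (hH : (Hess u x).PosDef)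
    {R a b c C₁ C₂ : ℝ} (hx : x ≠ 0) (hxR : ‖x‖ ≤ R) (hb : 0 ≤ b) (hbR : b ≤ R⁻¹)
    (hab : 0 ≤ a - b * (R - ‖x‖)) (hab1 : a - b * (R - ‖x‖) ≤ 1)
    (hk : ∀ v, |iteratedFDeriv ℝ 2 (fun y => w y - ‖y‖) x ![v, v]| ≤ c * ‖v‖ ^ 2)
    (hcb : c ≤ b / 4) (hw1 : ‖fderiv ℝ w x‖ ≤ C₁) (hC₂ : 0 < C₂)
    (hdet : (Hess u x).det * R ^ (n + 1) ≤ C₂) :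
    Llin s u (barrierFun R a b u w) x ≤ n + ((n : ℝ) + 2) * (n * (C₁ + 1))
      - b / 4 * (Hess u x)⁻¹.trace - n / 2 * (R ^ 2 * b / C₂) ^ (1 / (n : ℝ)) := by
  have hx0 : 0 < ‖x‖ := norm_pos_iff.2 hx
  have hR : 0 < R := hx0.trans_le hxR
  set ν : Euc n := ‖x‖⁻¹ • x with hνdef
  have hν : ‖ν‖ = 1 := by
    rw [hνdef, norm_smul, norm_inv, norm_norm, inv_mul_cancel₀ hx0.ne']
  have hin : ∀ v : Euc n, ⟪x, v⟫ / ‖x‖ = ⟪ν, v⟫ := fun v => by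
    rw [hνdef, real_inner_smul_left, div_eq_inv_mul]
  have hθ := contDiffAt_barrierFun (R := R) (a := a) (b := b) hu hw hx
  set θ := barrierFun R a b u w with hθdef
  have hM : (Hess u x + c • (1 : Matrix (Fin n) (Fin n) ℝ) - radialMatrix R⁻¹ b ν
      - Hess θ x).PosSemidef := by
    refine Matrix.posSemidef_of_sum (fun i j => ?_) fun v => ?_
    · simp [radialMatrix_symm _ _ ν i j, Matrix.one_apply, eq_comm, Hess_symm hu i j,
        Hess_symm hθ i j]
    · have e1 := sum_Hess u x (WithLp.toLp 2 v)
      have e2 := sum_Hess θ x (WithLp.toLp 2 v)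
      have e3 := sum_radialMatrix R⁻¹ b ν (WithLp.toLp 2 v)
      have e4 := sum_one (WithLp.toLp 2 v)
      have e5 := iteratedFDeriv_barrierFun (R := R) (a := a) (b := b) hu hw hx (WithLp.toLp 2 v)
      have e6 := iteratedFDeriv_sub_norm hw hx (WithLp.toLp 2 v)
      have e7 := hk (WithLp.toLp 2 v)
      have e8 := inner_sq_le_of_norm_eq_one hν (WithLp.toLp 2 v)
      rw [hin] at e5 e6
      simp only [Matrix.sub_apply, Matrix.add_apply, Matrix.smul_apply, smul_eq_mul, mul_sub,
        mul_add, Finset.sum_sub_distrib, Finset.sum_add_distrib, mul_left_comm _ c,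
        ← Finset.mul_sum]
      dsimp only at e1 e2 e3 e4
      rw [e1, e2, e3, e4, e5]
      rw [e6] at e7
      have e9 : R⁻¹ * (‖(WithLp.toLp 2 v : Euc n)‖ ^ 2 - ⟪ν, WithLp.toLp 2 v⟫ ^ 2)
          ≤ (‖(WithLp.toLp 2 v : Euc n)‖ ^ 2 - ⟪ν, WithLp.toLp 2 v⟫ ^ 2) / ‖x‖ := by
        rw [inv_mul_eq_div]
        exact div_le_div_of_nonneg_left (by linarith) hx0 hxR
      have e10 := mul_nonneg hab (div_nonneg (sub_nonneg.2 e8) hx0.le)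
      have e11 := neg_abs_le (iteratedFDeriv ℝ 2 w x ![WithLp.toLp 2 v, WithLp.toLp 2 v]
        - (‖(WithLp.toLp 2 v : Euc n)‖ ^ 2 - ⟪ν, WithLp.toLp 2 v⟫ ^ 2) / ‖x‖)
      nlinarith
  have h1 := hH.trace_inv_mul_le hM
  have h2 := mul_trace_inv_le_trace_mul_radialMatrix hH hbR hν
  have h3 := rpow_le_trace_mul_radialMatrix hH hn hR hb hbR hν hC₂ hdet
  have h4 : ∑ i, ∑ j, (Hess u x)⁻¹ i j * Hess θ x i j = ((Hess u x)⁻¹ * Hess θ x).trace := by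
    simp only [Matrix.trace, Matrix.diag_apply, Matrix.mul_apply]
    exact Finset.sum_congr rfl fun i _ => Finset.sum_congr rfl fun j _ => by
      rw [Hess_symm hθ i j]
  have h5 : 0 ≤ (Hess u x)⁻¹.trace := hH.inv.posSemidef.trace_nonneg
  have h6 : ∀ i : Fin n, fderiv ℝ θ x (EuclideanSpace.single i 1)
      = fderiv ℝ u x (EuclideanSpace.single i 1) - (fderiv ℝ w x (EuclideanSpace.single i 1)
        + (a - b * (R - ‖x‖)) * ⟪ν, EuclideanSpace.single i (1 : ℝ)⟫) := fun i => by
    rw [hθdef, fderiv_barrierFun hu hw hx, hin]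
    ring
  have h7 : ∀ i : Fin n, |fderiv ℝ w x (EuclideanSpace.single i 1)
        + (a - b * (R - ‖x‖)) * ⟪ν, EuclideanSpace.single i (1 : ℝ)⟫| ≤ C₁ + 1 := fun i => by
    refine (abs_add_le _ _).trans (add_le_add ?_ ?_)
    · have := (fderiv ℝ w x).le_opNorm (EuclideanSpace.single i (1 : ℝ))
      simp only [Real.norm_eq_abs, PiLp.norm_single, abs_one, mul_one] at this
      exact this.trans hw1
    · have := abs_real_inner_le_norm ν (EuclideanSpace.single i (1 : ℝ))
      simp only [hν, PiLp.norm_single, norm_one, mul_one] at this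
      rw [abs_mul, abs_of_nonneg hab]
      exact mul_le_one₀ hab1 (abs_nonneg _) this
  have h8 := neg_first_order_le (p := fun i : Fin n => fderiv ℝ u x (EuclideanSpace.single i 1)) h7
  simp only [Llin, HessW_eq_Hess hs, pdW_eq hs, h4, h6]
  have h9 := mul_le_mul_of_nonneg_right hcb h5
  linarith

end PointwiseEstimate

section MainEstimate

variable {n : ℕ}

theorem rpow_three_quarters_le {R : ℝ} (hR : 256 ≤ R) : R ^ ((3 : ℝ) / 4) ≤ R / 4 := by
  have hR0 : 0 < R := by linarith
  have h1 : (4 : ℝ) ≤ R ^ ((1 : ℝ) / 4) := by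
    have h := Real.rpow_le_rpow (by norm_num) hR (by norm_num : (0 : ℝ) ≤ 1 / 4)
    have h2 : (256 : ℝ) ^ ((1 : ℝ) / 4) = 4 := by
      rw [show (256 : ℝ) = 4 ^ (4 : ℝ) by norm_num, ← Real.rpow_mul (by norm_num)]
      norm_num
    rwa [h2] at h
  have h2 : R ^ ((3 : ℝ) / 4) * R ^ ((1 : ℝ) / 4) = R := by
    rw [← Real.rpow_add hR0]
    norm_num
  nlinarith [Real.rpow_nonneg hR0.le ((3 : ℝ) / 4)]

/-- On the set considered, the distance to the sphere of radius `R` is at most `R ^ (3 / 4)`. -/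
theorem sub_norm_le_of_mem_closedBall {last : Fin n} {R δ : ℝ} (hR : 0 ≤ R) {x : Euc n}
    (hx : x ∈ closedBall (EuclideanSpace.single last R) δ) : R - ‖x‖ ≤ δ := by
  have h1 := norm_sub_norm_le (EuclideanSpace.single last R) x
  rw [PiLp.norm_single, Real.norm_of_nonneg hR, ← dist_eq_norm, dist_comm] at h1
  exact h1.trans hx

theorem sq_mul_rpow {R : ℝ} (hR : 0 < R) : R ^ 2 * R ^ (-(5 : ℝ) / 4) = R ^ ((3 : ℝ) / 4) := by
  rw [← Real.rpow_natCast, ← Real.rpow_add hR]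
  norm_num

theorem rpow_mul_le_of_le {R d : ℝ} (hR : 0 < R) (hd : d ≤ R ^ ((3 : ℝ) / 4)) :
    R ^ (-(5 : ℝ) / 4) * d ≤ R ^ (-(1 : ℝ) / 2) := by
  refine (mul_le_mul_of_nonneg_left hd (by positivity)).trans_eq ?_
  rw [← Real.rpow_add hR]
  norm_num

theorem abs_iteratedFDeriv_two_le (k : Euc n → ℝ) (x v : Euc n) :
    |iteratedFDeriv ℝ 2 k x ![v, v]| ≤ ‖iteratedFDeriv ℝ 2 k x‖ * ‖v‖ ^ 2 := by
  have h := (iteratedFDeriv ℝ 2 k x).le_opNorm ![v, v]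
  simpa [Fin.prod_univ_two, sq] using h

variable (S : ExtSetting n)

theorem ExtSetting.exists_abs_iteratedFDeriv_ul_sub_le : ∃ C R₁ : ℝ, ∀ R : ℝ, R₁ ≤ R → 0 < R →
    ∀ x : Euc n, 3 * R / 4 ≤ ‖x‖ → ∀ v : Euc n,
      |iteratedFDeriv ℝ 2 (fun y => S.ul y - ‖y‖) x ![v, v]| ≤ C / R ^ 2 * ‖v‖ ^ 2 := by
  obtain ⟨C, R₁, h⟩ := S.huldec2
  refine ⟨2 * |C|, 2 * |R₁|, fun R hR hR0 x hx v => (abs_iteratedFDeriv_two_le _ x v).trans ?_⟩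
  have h1 := h x (by linarith [le_abs_self R₁, abs_nonneg R₁])
  have h2 := norm_nonneg (iteratedFDeriv ℝ 3 S.ul x)
  have h3 : C / ‖x‖ ^ 2 ≤ 2 * |C| / R ^ 2 := by
    have hx0 : 0 < ‖x‖ := by linarith
    rw [div_le_div_iff₀ (by positivity) (by positivity)]
    have h4 : R ^ 2 ≤ 2 * ‖x‖ ^ 2 := by nlinarith
    nlinarith [le_abs_self C, abs_nonneg C, sq_nonneg R,
      mul_le_mul_of_nonneg_right (le_abs_self C) (sq_nonneg R),
      mul_le_mul_of_nonneg_left h4 (abs_nonneg C)]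
  gcongr
  linarith

theorem vartheta_nonneg {last : Fin n} {R : ℝ} (hR : 256 ≤ R) (hR₀ : 4 * S.R₀ < R)
    {u : Euc n → ℝ} (hu : IsSol S R u) {x : Euc n}
    (hx : x ∈ closedBall (EuclideanSpace.single last R) (R ^ ((3 : ℝ) / 4)))
    (hxR : x ∈ closedBall (0 : Euc n) R) : 0 ≤ vartheta R u S.ul x := by
  have hR0 : 0 < R := by linarith
  have h1 := sub_norm_le_of_mem_closedBall hR0.le hx
  have h2 := rpow_three_quarters_le hR
  rw [mem_closedBall_zero_iff] at hxR
  have h3 := hu.ul_le x (S.mem_solDom (by linarith) hxR)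
  have h4 := rpow_mul_le_of_le hR0 h1
  have h5 : 0 ≤ R ^ (-(5 : ℝ) / 4) * (R - ‖x‖) :=
    mul_nonneg (by positivity) (sub_nonneg.2 hxR)
  have h6 := mul_nonneg (sub_nonneg.2 hxR)
    (by linarith : 0 ≤ R ^ (-(1 : ℝ) / 2) - 1 / 2 * (R ^ (-(5 : ℝ) / 4) * (R - ‖x‖)))
  unfold vartheta
  linarith

theorem ExtSetting.exists_Llin_vartheta_le : ∃ C₁ C₂ C₃ R₁ : ℝ, 0 < C₂ ∧ ∀ R : ℝ,
    4 * S.R₀ < R → R₁ ≤ R → C₃ ≤ R ^ ((3 : ℝ) / 4) → ∀ u : Euc n → ℝ, IsSol S R u →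
      ∀ last : Fin n, ∀ x ∈ ball (EuclideanSpace.single last R) (R ^ ((3 : ℝ) / 4)) ∩ ball 0 R,
        Llin (solDom S R) u (vartheta R u S.ul) x ≤ C₁
          - R ^ (-(5 : ℝ) / 4) / 4 * (HessW (solDom S R) u x)⁻¹.trace
          - n / 2 * (R ^ ((3 : ℝ) / 4) / C₂) ^ (1 / (n : ℝ)) := by
  obtain ⟨C₁, R₁, -, -, -, h1⟩ := S.exists_norm_fderiv_ul_sub_le
  obtain ⟨C₂, R₂, hC₂, h2⟩ := S.exists_det_Hess_le
  obtain ⟨C₃, R₃, h3⟩ := S.exists_abs_iteratedFDeriv_ul_sub_le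
  refine ⟨n + ((n : ℝ) + 2) * (n * (C₁ + 1)), C₂, 4 * C₃, max (max 256 (2 * |R₁|)) (max R₂ R₃),
    hC₂, fun R hR₀ hR hR' u hu last x hx => ?_⟩
  simp only [max_le_iff] at hR
  obtain ⟨⟨hR256, hRR₁⟩, hRR₂, hRR₃⟩ := hR
  have hR0 : 0 < R := by linarith
  have hxR := mem_ball_zero_iff.1 hx.2
  have hd := sub_norm_le_of_mem_closedBall hR0.le (ball_subset_closedBall hx.1)
  have hx34 : 3 * R / 4 ≤ ‖x‖ := by linarith [rpow_three_quarters_le hR256]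
  have hxm := S.mem_ball_diff (by linarith) hxR
  have hs := S.solDom_mem_nhds hxm
  have hb : 0 ≤ R ^ (-(5 : ℝ) / 4) := by positivity
  rw [HessW_eq_Hess hs, ← sq_mul_rpow hR0]
  refine Llin_barrierFun_le (c := C₃ / R ^ 2) hs S.n_pos (hu.contDiffAt hxm)
    (S.contDiffAt_ul hxm.2) (hu.2.1 x hxm) (norm_pos_iff.1 (by linarith)) hxR.le hb ?_ ?_ ?_
    (h3 R hRR₃ hR0 x hx34) ?_ (h1 x (by linarith [le_abs_self R₁, abs_nonneg R₁])).2 hC₂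
    (h2 R hR₀ hRR₂ u hu x hx34 hxR)
  · rw [← Real.rpow_neg_one]
    exact Real.rpow_le_rpow_of_exponent_le (by linarith) (by norm_num)
  · exact sub_nonneg.2 (rpow_mul_le_of_le hR0 hd)
  · have h4 := mul_nonneg hb (sub_nonneg.2 hxR.le)
    have h5 := Real.rpow_le_one_of_one_le_of_nonpos (by linarith : 1 ≤ R)
      (by norm_num : -(1 : ℝ) / 2 ≤ 0)
    linarith
  · rw [← sq_mul_rpow hR0] at hR'
    rw [div_le_iff₀ (by positivity)]
    linarith

end MainEstimate

theorem vartheta_barrier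
    (n : ℕ) (S : ExtSetting n) (last : Fin n) (hlast : (last : ℕ) = n - 1) :
    ∃ ε : ℝ, 0 < ε ∧ ∃ R₁ : ℝ, ∀ R : ℝ, 4 * S.R₀ < R → R₁ ≤ R →
      ∀ u : Euc n → ℝ, IsSol S R u →
        (∀ x ∈ ball (EuclideanSpace.single last R) (R ^ ((3 : ℝ) / 4)) ∩ ball (0 : Euc n) R,
          Llin (solDom S R) u (vartheta R u S.ul) x
            ≤ -ε * R ^ ((3 : ℝ) / (4 * (n : ℝ)))
              - ε * R ^ (-(5 : ℝ) / 4) * Matrix.trace (HessW (solDom S R) u x)⁻¹) ∧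
        (∀ x ∈ frontier
            (ball (EuclideanSpace.single last R) (R ^ ((3 : ℝ) / 4)) ∩ ball (0 : Euc n) R),
          0 ≤ vartheta R u S.ul x) := by
  obtain ⟨C₁, C₂, C₃, R₁, hC₂, h⟩ := S.exists_Llin_vartheta_le
  have hn : (0 : ℝ) < n := by exact_mod_cast S.n_pos
  have hε : 0 < n / 4 * (1 / C₂) ^ (1 / (n : ℝ)) := by positivity
  have ht := (tendsto_rpow_atTop (by positivity : 0 < (3 : ℝ) / (4 * (n : ℝ)))).const_mul_atTop hε
  obtain ⟨R₂, hR₂⟩ := eventually_atTop.1 ((ht.eventually_ge_atTop C₁).and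
    ((tendsto_rpow_atTop (by norm_num : (0 : ℝ) < 3 / 4)).eventually_ge_atTop C₃))
  refine ⟨min (1 / 4) (n / 4 * (1 / C₂) ^ (1 / (n : ℝ))), by positivity,
    max 256 (max R₁ R₂), fun R hR₀ hR u hu => ?_⟩
  simp only [max_le_iff] at hR
  obtain ⟨hR256, hRR₁, hRR₂⟩ := hR
  have hR0 : 0 < R := by linarith
  refine ⟨fun x hx => ?_, fun x hx => ?_⟩
  · obtain ⟨h1, h2⟩ := hR₂ R hRR₂
    have h3 := h R hR₀ hRR₁ h2 u hu last x hx
    have hxm := S.mem_ball_diff (x := x) (R := R) (by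
      have h4 := sub_norm_le_of_mem_closedBall hR0.le (ball_subset_closedBall hx.1)
      linarith [rpow_three_quarters_le hR256]) (mem_ball_zero_iff.1 hx.2)
    have h4 : 0 ≤ (HessW (solDom S R) u x)⁻¹.trace := by
      rw [HessW_eq_Hess (S.solDom_mem_nhds hxm)]
      exact (hu.2.1 x hxm).inv.posSemidef.trace_nonneg
    have h5 : (R ^ ((3 : ℝ) / 4) / C₂) ^ (1 / (n : ℝ))
        = (1 / C₂) ^ (1 / (n : ℝ)) * R ^ ((3 : ℝ) / (4 * (n : ℝ))) := by
      rw [div_eq_mul_one_div, Real.mul_rpow (by positivity) (by positivity),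
        ← Real.rpow_mul hR0.le, mul_comm]
      congr 2
      field_simp
    rw [h5] at h3
    have h6 := mul_le_mul_of_nonneg_right (min_le_right (1 / 4) (n / 4 * (1 / C₂) ^ (1 / (n : ℝ))))
      (by positivity : 0 ≤ R ^ ((3 : ℝ) / (4 * (n : ℝ))))
    have h7 := mul_le_mul_of_nonneg_right (min_le_left (1 / 4) (n / 4 * (1 / C₂) ^ (1 / (n : ℝ))))
      (mul_nonneg (by positivity : 0 ≤ R ^ (-(5 : ℝ) / 4)) h4)
    linarith
  · have h1 := closure_inter_subset_inter_closure _ _ (frontier_subset_closure hx)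
    exact vartheta_nonneg S hR256 hR₀ hu (closure_ball_subset_closedBall h1.1)
      (closure_ball_subset_closedBall h1.2)
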